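/- If b = a ≥ 1 (equal stair lengths), the minimum area of a polygon realizing the two-opposite-stair xy-monotone angle sequence with both stairs having a reflex vertices is exactly 2(a + 1), which is one more than the general lower bound (a+1)(q+1)(q+2)/2 − a + r(q+2) evaluated at b = a (i.e., q = 0, r = a). -/

import Mathlib

/-- Cross product of two planar integer vectors. -/
def cross (d e : ℤ × ℤ) : ℤ := d.1 * e.2 - d.2 * e.1

/-- Membership in an axis-parallel lattice segment with endpoints `a`, `b`. -/
def onSeg (a b p : ℤ × ℤ) : Prop :=
  min a.1 b.1 ≤ p.1 ∧ p.1 ≤ max a.1 b.1 ∧ min a.2 b.2 ≤ p.2 ∧ p.2 ≤ max a.2 b.2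

/-- A simple rectilinear lattice polygon with `n` vertices: all edges are
axis-parallel, consecutive edges are perpendicular, and non-adjacent edges are
disjoint (adjacent edges meet only in their common endpoint). -/
structure RectPolygon (n : ℕ) where
  v : ZMod n → ℤ × ℤ
  nondeg : ∀ i, v (i + 1) ≠ v i
  axis : ∀ i, (v (i + 1)).1 = (v i).1 ∨ (v (i + 1)).2 = (v i).2
  alt : ∀ i, ((v (i + 1)).1 = (v i).1 ↔ (v (i + 2)).2 = (v (i + 1)).2)
  simple : ∀ i j : ZMod n, j ≠ i → ∀ p : ℤ × ℤ,
    onSeg (v i) (v (i + 1)) p → onSeg (v j) (v (j + 1)) p →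
    (j = i + 1 ∧ p = v j) ∨ (i = j + 1 ∧ p = v i)

namespace RectPolygon

variable {n : ℕ}

/-- Vector of edge `i` (from vertex `i` to vertex `i+1`). -/
def dvec (P : RectPolygon n) (i : ZMod n) : ℤ × ℤ := P.v (i + 1) - P.v i

/-- The turn at vertex `i` is a left (+90°, convex) turn. -/
def convexAt (P : RectPolygon n) (i : ZMod n) : Prop := 0 < cross (P.dvec (i - 1)) (P.dvec i)

/-- The turn at vertex `i` is a right (−90°, reflex) turn. -/
def reflexAt (P : RectPolygon n) (i : ZMod n) : Prop := cross (P.dvec (i - 1)) (P.dvec i) < 0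

def horiz (P : RectPolygon n) (i : ZMod n) : Prop := (P.v (i + 1)).2 = (P.v i).2

def vert (P : RectPolygon n) (i : ZMod n) : Prop := (P.v (i + 1)).1 = (P.v i).1

/-- Signed x-extent of edge `i`. -/
def sx (P : RectPolygon n) (i : ZMod n) : ℤ := (P.v (i + 1)).1 - (P.v i).1

/-- Signed y-extent of edge `i`. -/
def sy (P : RectPolygon n) (i : ZMod n) : ℤ := (P.v (i + 1)).2 - (P.v i).2

/-- Length of edge `i`. -/
def elen (P : RectPolygon n) (i : ZMod n) : ℤ :=
  |(P.v (i + 1)).1 - (P.v i).1| + |(P.v (i + 1)).2 - (P.v i).2|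

section
variable [NeZero n]

/-- Counterclockwise orientation (positive shoelace signed area). -/
def ccw (P : RectPolygon n) : Prop := 0 < ∑ i : ZMod n, cross (P.v i) (P.v (i + 1))

/-- The enclosed area of a ccw polygon (shoelace formula); for a rectilinear
lattice polygon this is the number of interior unit grid cells. -/
def area (P : RectPolygon n) : ℤ := (∑ i : ZMod n, cross (P.v i) (P.v (i + 1))) / 2

/-- Perimeter: total length of all edges. -/
def perimeter (P : RectPolygon n) : ℤ := ∑ i : ZMod n, P.elen i

def maxX (P : RectPolygon n) : ℤ := Finset.univ.sup' Finset.univ_nonempty fun i : ZMod n => (P.v i).1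
def minX (P : RectPolygon n) : ℤ := Finset.univ.inf' Finset.univ_nonempty fun i : ZMod n => (P.v i).1
def maxY (P : RectPolygon n) : ℤ := Finset.univ.sup' Finset.univ_nonempty fun i : ZMod n => (P.v i).2
def minY (P : RectPolygon n) : ℤ := Finset.univ.inf' Finset.univ_nonempty fun i : ZMod n => (P.v i).2

/-- Width of the bounding box (a single unit edge gives width 1). -/
def width (P : RectPolygon n) : ℤ := P.maxX - P.minX

/-- Height of the bounding box. -/
def height (P : RectPolygon n) : ℤ := P.maxY - P.minY

/-- Area of the bounding box. -/
def bboxArea (P : RectPolygon n) : ℤ := P.width * P.height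

end

/-- A simple rectilinear polygon is x-monotone iff the cyclic sequence of
x-directions of its horizontal edges has exactly two reversals. -/
def IsXMonotone (P : RectPolygon n) : Prop :=
  {i : ZMod n | P.horiz i ∧ P.sx i * P.sx (i + 2) < 0}.ncard = 2

def IsYMonotone (P : RectPolygon n) : Prop :=
  {i : ZMod n | P.vert i ∧ P.sy i * P.sy (i + 2) < 0}.ncard = 2

def IsXYMonotone (P : RectPolygon n) : Prop := P.IsXMonotone ∧ P.IsYMonotone

/-- In a ccw x-monotone polygon, a reflex vertex lies on the upper chain iff its
adjacent horizontal edge points leftwards. -/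
def upperReflex (P : RectPolygon n) (i : ZMod n) : Prop :=
  P.reflexAt i ∧ ((P.horiz (i - 1) ∧ P.sx (i - 1) < 0) ∨ (P.horiz i ∧ P.sx i < 0))

def lowerReflex (P : RectPolygon n) (i : ZMod n) : Prop :=
  P.reflexAt i ∧ ((P.horiz (i - 1) ∧ 0 < P.sx (i - 1)) ∨ (P.horiz i ∧ 0 < P.sx i))

/-- Number of reflex vertices on the upper chain T. -/
noncomputable def rT (P : RectPolygon n) : ℕ := {i : ZMod n | P.upperReflex i}.ncard

/-- Number of reflex vertices on the lower chain B. -/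
noncomputable def rB (P : RectPolygon n) : ℕ := {i : ZMod n | P.lowerReflex i}.ncard

end RectPolygon

/-- The block (LR)^k of an angle sequence (`true` = L, `false` = R). -/
def LRblock (k : ℕ) : List Bool := (List.replicate k [true, false]).flatten

/-- `P` realizes the angle sequence `S` via a counterclockwise boundary walk. -/
def realizes {m : ℕ} [NeZero m] (S : List Bool) (P : RectPolygon m) : Prop :=
  m = S.length ∧ P.ccw ∧ ∀ i : Fin S.length,
    ((S.get i = true) ↔ P.convexAt ((i : ℕ) : ZMod m)) ∧
    ((S.get i = false) ↔ P.reflexAt ((i : ℕ) : ZMod m))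

instance (k : ℕ) : NeZero (k + 4) := ⟨by omega⟩

/-- The angle sequence of an xy-monotone polygon with two nonempty opposite
stairs BL (with `b` reflex vertices) and TR (with `a` reflex vertices):
cyclically L (LR)^b L L (LR)^a L, i.e. four extreme edges and two stairs. -/
def twoStairSeq (a b : ℕ) : List Bool :=
  [true] ++ LRblock b ++ [true, true] ++ LRblock a ++ [true]

/-- A lattice path all of whose steps are unit steps to the right or upwards. -/
def IsUnitStaircase (f : ℕ → ℤ × ℤ) : Prop :=
  ∀ s, f (s + 1) = f s + (1, 0) ∨ f (s + 1) = f s + (0, 1)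

theorem IsUnitStaircase.fst_add_snd {f : ℕ → ℤ × ℤ} (hf : IsUnitStaircase f) (s : ℕ) :
    (f s).1 + (f s).2 = (f 0).1 + (f 0).2 + s := by
  induction s with
  | zero => simp
  | succ s ih =>
    push_cast
    rcases hf s with h | h <;> rw [h] <;> simp only [Prod.fst_add, Prod.snd_add] <;> linarith

/-- The shoelace sum between two unit staircases with a common start is determined by the
differences of their abscissae on the antidiagonals. -/
theorem IsUnitStaircase.sum_cross_sub {f g : ℕ → ℤ × ℤ} (hf : IsUnitStaircase f)
    (hg : IsUnitStaircase g) (h0 : f 0 = g 0) (N : ℕ) :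
    ∑ s ∈ Finset.range N, cross (f s) (f (s + 1)) - ∑ s ∈ Finset.range N, cross (g s) (g (s + 1)) =
      2 * ∑ s ∈ Finset.range N, ((f s).1 - (g s).1)
        - (N - 1 + ((f 0).1 + (f 0).2)) * ((f N).1 - (g N).1) := by
  induction N with
  | zero => simp [h0]
  | succ N ih =>
    have e1 := hf.fst_add_snd N
    have e2 := hf.fst_add_snd (N + 1)
    have e3 := hg.fst_add_snd N
    have e4 := hg.fst_add_snd (N + 1)
    rw [← h0] at e3 e4
    rw [Finset.sum_range_succ, Finset.sum_range_succ, Finset.sum_range_succ]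
    simp only [cross]
    simp only [cross] at ih
    push_cast at *
    have e1' := eq_sub_of_add_eq' e1
    have e2' := eq_sub_of_add_eq' e2
    have e3' := eq_sub_of_add_eq' e3
    have e4' := eq_sub_of_add_eq' e4
    rw [e1', e2', e3', e4']
    linear_combination ih

/-- Two unit staircases which meet only at their common endpoints and bound a positive area
bound at least one cell on every intermediate antidiagonal. -/
theorem IsUnitStaircase.two_mul_le_sum_cross_sub {f g : ℕ → ℤ × ℤ} (hf : IsUnitStaircase f)
    (hg : IsUnitStaircase g) (h0 : f 0 = g 0) {N : ℕ} (hN : f N = g N)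
    (hne : ∀ s, 0 < s → s < N → f s ≠ g s)
    (hpos : 0 < ∑ s ∈ Finset.range N, cross (f s) (f (s + 1)) -
      ∑ s ∈ Finset.range N, cross (g s) (g (s + 1))) :
    2 * ((N : ℤ) - 1) ≤ ∑ s ∈ Finset.range N, cross (f s) (f (s + 1)) -
      ∑ s ∈ Finset.range N, cross (g s) (g (s + 1)) := by
  rw [hf.sum_cross_sub hg h0, hN, sub_self, mul_zero, sub_zero] at hpos ⊢
  obtain _ | N := N
  · simp at hpos
  rw [Finset.sum_range_succ', h0, sub_self, add_zero] at hpos ⊢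
  have hd : ∀ s, 0 < s → s < N + 1 → (f s).1 - (g s).1 ≠ 0 := by
    intro s hs hsN h
    refine hne s hs hsN (Prod.ext (by linarith) ?_)
    have e1 := hf.fst_add_snd s
    have e2 := hg.fst_add_snd s
    rw [h0] at e1
    linarith
  have hstep : ∀ s, |((f (s + 1)).1 - (g (s + 1)).1) - ((f s).1 - (g s).1)| ≤ 1 := by
    intro s
    rcases hf s with h | h <;> rcases hg s with h' | h' <;> rw [h, h', abs_le] <;>
      simp only [Prod.fst_add] <;> constructor <;> linarith
  have key : (∀ s < N, 1 ≤ (f (s + 1)).1 - (g (s + 1)).1) ∨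
      (∀ s < N, (f (s + 1)).1 - (g (s + 1)).1 ≤ -1) := by
    rcases le_total 0 ((f 1).1 - (g 1).1) with h1 | h1
    · left
      intro s hs
      have h := hd (s + 1) (by omega) (by omega)
      induction s with
      | zero => simp only [zero_add] at *; omega
      | succ s ih =>
        have i1 := ih (by omega) (hd (s + 1) (by omega) (by omega))
        have i2 := abs_le.1 (hstep (s + 1))
        omega
    · right
      intro s hs
      have h := hd (s + 1) (by omega) (by omega)
      induction s with
      | zero => simp only [zero_add] at *; omega
      | succ s ih =>
        have i1 := ih (by omega) (hd (s + 1) (by omega) (by omega))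
        have i2 := abs_le.1 (hstep (s + 1))
        omega
  rcases key with key | key
  · have := Finset.card_nsmul_le_sum (Finset.range N) (fun s => (f (s + 1)).1 - (g (s + 1)).1) 1
      (fun s hs => key s (Finset.mem_range.1 hs))
    simp only [Finset.card_range, nsmul_eq_mul, mul_one] at this
    push_cast
    linarith
  · have := Finset.sum_nonpos (s := Finset.range N) (f := fun s => (f (s + 1)).1 - (g (s + 1)).1)
      (fun s hs => (key s (Finset.mem_range.1 hs)).trans (by norm_num))
    linarith

/-- The step from `p` to `p'` goes right or upwards along a coordinate axis. -/
def IsStairStep (p p' : ℤ × ℤ) : Prop :=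
  (p.1 < p'.1 ∧ p'.2 = p.2) ∨ (p'.1 = p.1 ∧ p.2 < p'.2)

theorem sum_cross_straight (p e : ℤ × ℤ) (m : ℕ) :
    ∑ s ∈ Finset.range m, cross (p + s • e) (p + (s + 1) • e) = cross p (p + m • e) := by
  induction m with
  | zero => simp [cross, mul_comm]
  | succ m ih =>
    rw [Finset.sum_range_succ, ih]
    simp [cross]
    ring

theorem IsStairStep.exists_eq_add_nsmul {p p' : ℤ × ℤ} (h : IsStairStep p p') :
    ∃ (k : ℕ) (e : ℤ × ℤ), (e = (1, 0) ∨ e = (0, 1)) ∧ p' = p + k • e := by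
  rcases h with ⟨h1, h2⟩ | ⟨h1, h2⟩
  · refine ⟨(p'.1 - p.1).toNat, (1, 0), Or.inl rfl, Prod.ext ?_ ?_⟩ <;> simp <;> omega
  · refine ⟨(p'.2 - p.2).toNat, (0, 1), Or.inr rfl, Prod.ext ?_ ?_⟩ <;> simp <;> omega

theorem onSeg_add_nsmul {p e : ℤ × ℤ} (he : e = (1, 0) ∨ e = (0, 1)) {j k : ℕ} (hj : j ≤ k) :
    onSeg p (p + k • e) (p + j • e) := by
  rcases he with rfl | rfl <;> simp [onSeg] <;> omega

/-- A staircase subdivides into a unit staircase with the same shoelace sum. -/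
theorem exists_isUnitStaircase (q : ℕ → ℤ × ℤ) (m : ℕ)
    (hq : ∀ i < m, IsStairStep (q i) (q (i + 1))) :
    ∃ (N : ℕ) (f : ℕ → ℤ × ℤ), IsUnitStaircase f ∧ f 0 = q 0 ∧ f N = q m ∧
      (∀ s < N, ∃ i < m, onSeg (q i) (q (i + 1)) (f s)) ∧
      ∑ s ∈ Finset.range N, cross (f s) (f (s + 1)) =
        ∑ i ∈ Finset.range m, cross (q i) (q (i + 1)) := by
  induction m with
  | zero =>
    refine ⟨0, fun s => q 0 + ((s : ℤ), 0), fun s => Or.inl ?_, ?_, ?_, ?_, ?_⟩ <;>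
      simp [add_assoc]
  | succ m ih =>
    obtain ⟨N, f, hf, hf0, hfN, hfs, hsum⟩ := ih fun i hi => hq i (by omega)
    obtain ⟨k, e, he, hk⟩ := (hq m (by omega)).exists_eq_add_nsmul
    have hlo : ∀ s ≤ N, (fun s => if s ≤ N then f s else q m + (s - N) • e) s = f s :=
      fun s hs => if_pos hs
    have hhi : ∀ j, (fun s => if s ≤ N then f s else q m + (s - N) • e) (N + j) =
        q m + j • e := by
      rintro (_ | j)
      · simp [hfN]
      · simp only [Nat.add_sub_cancel_left]
        rw [if_neg (by omega)]
    generalize (fun s => if s ≤ N then f s else q m + (s - N) • e) = g at hlo hhi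
    refine ⟨N + k, g, fun s => ?_, ?_, ?_, fun s hs => ?_, ?_⟩
    · rcases lt_or_ge s N with h | h
      · rw [hlo s h.le, hlo (s + 1) h]
        exact hf s
      · obtain ⟨j, rfl⟩ := Nat.exists_eq_add_of_le h
        rw [add_assoc, hhi, hhi, succ_nsmul, ← add_assoc]
        rcases he with rfl | rfl
        · exact Or.inl rfl
        · exact Or.inr rfl
    · rw [hlo 0 (by omega), hf0]
    · rw [hhi, hk]
    · rcases lt_or_ge s N with h | h
      · obtain ⟨i, hi, hi'⟩ := hfs s h
        exact ⟨i, by omega, by rwa [hlo s h.le]⟩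
      · obtain ⟨j, rfl⟩ := Nat.exists_eq_add_of_le h
        refine ⟨m, by omega, ?_⟩
        rw [hhi, hk]
        exact onSeg_add_nsmul he (by omega)
    · rw [Finset.sum_range_add, Finset.sum_range_succ, ← hsum, hk, ← sum_cross_straight]
      congr 1
      · refine Finset.sum_congr rfl fun s hs => ?_
        have := Finset.mem_range.1 hs
        rw [hlo s (by omega), hlo (s + 1) (by omega)]
      · refine Finset.sum_congr rfl fun s hs => ?_
        rw [add_assoc, hhi, hhi]

theorem le_sum_of_isStairStep (q : ℕ → ℤ × ℤ) {m i j : ℕ}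
    (hq : ∀ i < m, IsStairStep (q i) (q (i + 1))) (hij : i ≤ j) (hj : j ≤ m) :
    (q i).1 + (q i).2 + (j - i) ≤ (q j).1 + (q j).2 := by
  induction j, hij using Nat.le_induction with
  | base => simp
  | succ j hij ih =>
    have h1 := ih (by omega)
    have h2 := hq j (by omega)
    simp only [IsStairStep] at h2
    push_cast
    omega

theorem length_LRblock (k : ℕ) : (LRblock k).length = 2 * k := by
  simp [LRblock, mul_comm]

theorem LRblock_getElem? (k i : ℕ) (hi : i < 2 * k) :
    (LRblock k)[i]? = some (decide (i % 2 = 0)) := by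
  induction k generalizing i with
  | zero => omega
  | succ k ih =>
    have h : LRblock (k + 1) = true :: false :: LRblock k := by
      simp [LRblock, List.replicate_succ]
    rw [h]
    obtain _ | _ | i := i
    · rfl
    · rfl
    · simp only [List.getElem?_cons_succ, ih i (by omega)]
      congr 2
      rw [eq_iff_iff]
      omega

theorem length_twoStairSeq (a b : ℕ) : (twoStairSeq a b).length = 2 * (a + b) + 4 := by
  simp [twoStairSeq, length_LRblock]
  omega

theorem twoStairSeq_getElem (a i : ℕ) (hi : i < (twoStairSeq a a).length) :
    (twoStairSeq a a)[i] = decide (i = 0 ∨ i % 2 = 1 ∨ i = 2 * a + 2) := by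
  have hl := length_twoStairSeq a a
  rw [← Option.some_inj, ← List.getElem?_eq_getElem hi]
  have hb := length_LRblock a
  simp only [twoStairSeq]
  rcases lt_or_ge i 1 with h1 | h1
  · obtain rfl : i = 0 := by omega
    simp
  obtain ⟨i, rfl⟩ := Nat.exists_eq_add_of_le' h1
  simp only [List.append_assoc, List.cons_append, List.nil_append, List.getElem?_cons_succ]
  rcases lt_or_ge i (2 * a) with h2 | h2
  · rw [List.getElem?_append_left (by omega), LRblock_getElem? _ _ h2]
    congr 2
    rw [eq_iff_iff]
    omega
  rw [List.getElem?_append_right (by omega), hb]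
  obtain ⟨i, rfl⟩ := Nat.exists_eq_add_of_le h2
  rw [Nat.add_sub_cancel_left]
  obtain _ | _ | i := i
  · simp
  · simp
  simp only [List.getElem?_cons_succ]
  rcases lt_or_ge i (2 * a) with h3 | h3
  · rw [List.getElem?_append_left (by omega), LRblock_getElem? _ _ h3]
    congr 2
    rw [eq_iff_iff]
    omega
  · obtain rfl : i = 2 * a := by omega
    rw [List.getElem?_append_right (by omega), hb]
    simp
    omega

theorem ZMod.natCast_inj_of_lt {n i j : ℕ} (hi : i < n) (hj : j < n) :
    (i : ZMod n) = (j : ZMod n) ↔ i = j := by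
  rw [ZMod.natCast_eq_natCast_iff', Nat.mod_eq_of_lt hi, Nat.mod_eq_of_lt hj]

theorem ZMod.sum_eq_sum_range {n : ℕ} [NeZero n] (F : ZMod n → ℤ) :
    ∑ i, F i = ∑ k ∈ Finset.range n, F (k : ZMod n) := by
  refine Finset.sum_bij' (fun i _ => i.val) (fun k _ => (k : ZMod n)) ?_ ?_ ?_ ?_ ?_
  · exact fun i _ => Finset.mem_range.2 (ZMod.val_lt i)
  · exact fun _ _ => Finset.mem_univ _
  · exact fun i _ => ZMod.natCast_rightInverse i
  · exact fun k hk => ZMod.val_cast_of_lt (Finset.mem_range.1 hk)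
  · exact fun i _ => by rw [ZMod.natCast_rightInverse i]

namespace RectPolygon

variable {n : ℕ}

theorem sum_cross_eq_sum_range [NeZero n] (P : RectPolygon n) :
    ∑ i : ZMod n, cross (P.v i) (P.v (i + 1)) =
      ∑ k ∈ Finset.range n, cross (P.v (k : ℕ)) (P.v ((k + 1 : ℕ))) := by
  rw [ZMod.sum_eq_sum_range]
  simp only [Nat.cast_add, Nat.cast_one]

theorem eq_of_onSeg_of_onSeg (P : RectPolygon n) {i j : ℕ} (hij : i < j) (hj : j < n)
    {p : ℤ × ℤ} (h1 : onSeg (P.v (i : ℕ)) (P.v ((i + 1 : ℕ))) p)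
    (h2 : onSeg (P.v (j : ℕ)) (P.v ((j + 1 : ℕ))) p) :
    (j = i + 1 ∧ p = P.v (j : ℕ)) ∨ (i = 0 ∧ j + 1 = n ∧ p = P.v (i : ℕ)) := by
  have hne : (j : ZMod n) ≠ (i : ZMod n) := by
    rw [Ne, ZMod.natCast_inj_of_lt hj (by omega)]
    omega
  push_cast at h1 h2
  rcases P.simple i j hne p h1 h2 with ⟨h, hp⟩ | ⟨h, hp⟩
  · left
    refine ⟨?_, hp⟩
    rwa [← Nat.cast_succ, ZMod.natCast_inj_of_lt hj (by omega)] at h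
  · right
    rcases Nat.lt_or_ge (j + 1) n with hlt | hge
    · rw [← Nat.cast_succ, ZMod.natCast_inj_of_lt (by omega) hlt] at h
      omega
    · obtain rfl : n = j + 1 := by omega
      rw [← Nat.cast_succ, ZMod.natCast_self, ← Nat.cast_zero,
        ZMod.natCast_inj_of_lt (by omega) (by omega)] at h
      exact ⟨h, rfl, hp⟩

/-- The polygon rotated clockwise by a quarter turn about the origin. -/
def rot (P : RectPolygon n) : RectPolygon n where
  v i := ((P.v i).2, -(P.v i).1)
  nondeg i h := P.nondeg i <| by
    simp only [Prod.mk.injEq, neg_inj] at h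
    exact Prod.ext h.2 h.1
  axis i := by simpa only [neg_inj] using (P.axis i).symm
  alt i := by
    have h0 := P.alt i
    have h1 := P.axis i
    have h2 := P.axis (i + 1)
    have h3 := P.nondeg i
    have h4 := P.nondeg (i + 1)
    rw [add_assoc, one_add_one_eq_two] at h2 h4
    simp only [Ne, Prod.ext_iff] at h3 h4
    simp only [neg_inj]
    tauto
  simple i j hij p h1 h2 := by
    have h := P.simple i j hij (-p.2, p.1)
      (by simp only [onSeg] at h1 ⊢; omega) (by simp only [onSeg] at h2 ⊢; omega)
    rcases h with ⟨h, hp⟩ | ⟨h, hp⟩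
    · exact Or.inl ⟨h, by rw [← hp, neg_neg]⟩
    · exact Or.inr ⟨h, by rw [← hp, neg_neg]⟩

theorem cross_rot_v (P : RectPolygon n) (i j : ZMod n) :
    cross (P.rot.v i) (P.rot.v j) = cross (P.v i) (P.v j) := by
  simp only [cross, rot]
  ring

theorem cross_rot_dvec (P : RectPolygon n) (i j : ZMod n) :
    cross (P.rot.dvec i) (P.rot.dvec j) = cross (P.dvec i) (P.dvec j) := by
  simp only [cross, rot, dvec, Prod.fst_sub, Prod.snd_sub]
  ring

theorem area_rot [NeZero n] (P : RectPolygon n) : P.rot.area = P.area := by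
  simp only [area, cross_rot_v]

end RectPolygon

theorem realizes.rot {m : ℕ} [NeZero m] {S : List Bool} {P : RectPolygon m} (h : realizes S P) :
    realizes S P.rot := by
  simpa only [realizes, RectPolygon.ccw, RectPolygon.convexAt, RectPolygon.reflexAt,
    RectPolygon.cross_rot_v, RectPolygon.cross_rot_dvec] using h

/-- Once its first edge points right, a realization of the two-stair sequence consists of a
right-up stair followed by a left-down stair. -/
theorem realizes.edge_direction {a : ℕ} {P : RectPolygon (2 * (a + a) + 4)}
    (h : realizes (twoStairSeq a a) P) (h0 : (P.v ((0 : ℕ))).1 < (P.v ((1 : ℕ))).1) (k : ℕ)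
    (hk : k < 2 * (a + a) + 4) :
    (k < 2 * a + 2 → k % 2 = 0 → (P.v (k : ℕ)).1 < (P.v ((k + 1 : ℕ))).1 ∧
      (P.v ((k + 1 : ℕ))).2 = (P.v (k : ℕ)).2) ∧
    (k < 2 * a + 2 → k % 2 = 1 → (P.v ((k + 1 : ℕ))).1 = (P.v (k : ℕ)).1 ∧
      (P.v (k : ℕ)).2 < (P.v ((k + 1 : ℕ))).2) ∧
    (2 * a + 2 ≤ k → k % 2 = 0 → (P.v ((k + 1 : ℕ))).1 < (P.v (k : ℕ)).1 ∧
      (P.v (k : ℕ)).2 = (P.v ((k + 1 : ℕ))).2) ∧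
    (2 * a + 2 ≤ k → k % 2 = 1 → (P.v (k : ℕ)).1 = (P.v ((k + 1 : ℕ))).1 ∧
      (P.v ((k + 1 : ℕ))).2 < (P.v (k : ℕ)).2) := by
  induction k with
  | zero =>
    have h1 := P.axis ((0 : ℕ))
    rw [← Nat.cast_succ] at h1
    simp only [Nat.succ_eq_add_one, zero_add] at *
    omega
  | succ k ih =>
    have ih := ih (by omega)
    have h1 := P.axis ((k : ℕ))
    have h2 := P.axis ((k + 1 : ℕ))
    have h3 := P.nondeg ((k : ℕ))
    have h4 := P.nondeg ((k + 1 : ℕ))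
    have h5 := P.alt ((k : ℕ))
    have ht := h.2.2 ⟨k + 1, by rw [length_twoStairSeq]; omega⟩
    simp only [List.get_eq_getElem, twoStairSeq_getElem, RectPolygon.convexAt,
      RectPolygon.reflexAt, RectPolygon.dvec, cross, Prod.fst_sub, Prod.snd_sub,
      decide_eq_true_eq, decide_eq_false_iff_not] at ht
    have e1 : (k : ZMod (2 * (a + a) + 4)) + 1 = ((k + 1 : ℕ)) := by push_cast; rfl
    have e2 : (k : ZMod (2 * (a + a) + 4)) + 2 = ((k + 1 + 1 : ℕ)) := by push_cast; ring
    have e3 : ((k + 1 : ℕ) : ZMod (2 * (a + a) + 4)) + 1 = ((k + 1 + 1 : ℕ)) := by push_cast; rfl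
    have e4 : ((k + 1 : ℕ) : ZMod (2 * (a + a) + 4)) - 1 = (k : ℕ) := by push_cast; ring
    rw [e4, e1, e3] at ht
    rw [e1] at h1 h3 h5
    rw [e2] at h5
    rw [e3] at h2 h4
    simp only [Ne, Prod.ext_iff] at h3 h4
    generalize P.v (k : ℕ) = p at *
    generalize P.v ((k + 1 : ℕ)) = q at *
    generalize P.v ((k + 1 + 1 : ℕ)) = r at *
    have hm : (q.2 - p.2 = 0 ∧ r.1 - q.1 = 0) ∨ (q.1 - p.1 = 0 ∧ r.2 - q.2 = 0) := by omega
    rcases hm with ⟨z1, z2⟩ | ⟨z1, z2⟩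
    · rw [z1, z2, zero_mul, sub_zero, mul_pos_iff, mul_neg_iff] at ht
      omega
    · rw [z1, z2, zero_mul, zero_sub, neg_pos, neg_lt_zero, mul_pos_iff, mul_neg_iff] at ht
      omega

theorem realizes.le_area_of_first_edge_right {a : ℕ} (ha : 1 ≤ a)
    {P : RectPolygon (2 * (a + a) + 4)} (h : realizes (twoStairSeq a a) P)
    (h0 : (P.v ((0 : ℕ))).1 < (P.v ((1 : ℕ))).1) : 2 * ((a : ℤ) + 1) ≤ P.area := by
  have hdir := h.edge_direction h0
  have hsim := fun (i j : ℕ) hij hj p => P.eq_of_onSeg_of_onSeg (i := i) (j := j) (p := p) hij hj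
  have hccw := h.2.1
  have hclose : P.v ((2 * (a + a) + 4 : ℕ)) = P.v ((0 : ℕ)) := by
    rw [ZMod.natCast_self, Nat.cast_zero]
  rw [RectPolygon.ccw] at hccw
  rw [RectPolygon.area]
  rw [P.sum_cross_eq_sum_range] at hccw ⊢
  generalize hq : (fun k : ℕ => P.v (k : ZMod (2 * (a + a) + 4))) = q
  have hq' : ∀ k : ℕ, P.v (k : ZMod (2 * (a + a) + 4)) = q k := fun k => by rw [← hq]
  simp only [hq'] at *
  clear hq hq' h h0
  have hlow : ∀ i < 2 * a + 2, IsStairStep (q i) (q (i + 1)) := by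
    intro i hi
    have := hdir i (by omega)
    simp only [IsStairStep]
    omega
  have hup : ∀ i < 2 * a + 2, IsStairStep (q (2 * (a + a) + 4 - i))
      (q (2 * (a + a) + 4 - (i + 1))) := by
    intro i hi
    have := hdir (2 * (a + a) + 4 - (i + 1)) (by omega)
    rw [show 2 * (a + a) + 4 - (i + 1) + 1 = 2 * (a + a) + 4 - i by omega] at this
    simp only [IsStairStep]
    omega
  have hsum : ∑ k ∈ Finset.range (2 * (a + a) + 4), cross (q k) (q (k + 1)) =
      ∑ k ∈ Finset.range (2 * a + 2), cross (q k) (q (k + 1)) -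
      ∑ i ∈ Finset.range (2 * a + 2), cross (q (2 * (a + a) + 4 - i))
        (q (2 * (a + a) + 4 - (i + 1))) := by
    rw [show Finset.range (2 * (a + a) + 4) = Finset.range ((2 * a + 2) + (2 * a + 2)) by
      congr 1; omega, Finset.sum_range_add, sub_eq_add_neg]
    congr 1
    rw [← Finset.sum_range_reflect, ← Finset.sum_neg_distrib]
    refine Finset.sum_congr rfl fun i hi => ?_
    have hi := Finset.mem_range.1 hi
    rw [show 2 * a + 2 + (2 * a + 2 - 1 - i) = 2 * (a + a) + 4 - (i + 1) by omega,
      show 2 * (a + a) + 4 - (i + 1) + 1 = 2 * (a + a) + 4 - i by omega]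
    simp only [cross]
    ring
  obtain ⟨N, f, hf, hf0, hfN, hfs, hfsum⟩ := exists_isUnitStaircase q (2 * a + 2) hlow
  obtain ⟨N', g, hg, hg0, hgN, hgs, hgsum⟩ :=
    exists_isUnitStaircase (fun i => q (2 * (a + a) + 4 - i)) (2 * a + 2) hup
  rw [show 2 * (a + a) + 4 - (2 * a + 2) = 2 * a + 2 by omega] at hgN
  rw [Nat.sub_zero, hclose] at hg0
  have hfg0 : f 0 = g 0 := hf0.trans hg0.symm
  have efN := hf.fst_add_snd N
  have egN := hg.fst_add_snd N'
  obtain rfl : N' = N := by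
    rw [hfN, hf0] at efN
    rw [hgN, hg0] at egN
    omega
  have hne : ∀ s, 0 < s → s < N' → f s ≠ g s := by
    intro s hs hsN heq
    obtain ⟨i, hi, hi'⟩ := hfs s hsN
    obtain ⟨j, hj, hj'⟩ := hgs s hsN
    have es := hf.fst_add_snd s
    have hj'' : onSeg (q (2 * (a + a) + 4 - (j + 1)))
        (q (2 * (a + a) + 4 - (j + 1) + 1)) (f s) := by
      rw [show 2 * (a + a) + 4 - (j + 1) + 1 = 2 * (a + a) + 4 - j by omega, heq]
      simp only [onSeg] at hj' ⊢
      omega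
    rcases hsim i (2 * (a + a) + 4 - (j + 1)) (by omega) (by omega) (f s) hi' hj'' with
      ⟨h1, h2⟩ | ⟨h1, -, h2⟩
    · rw [show 2 * (a + a) + 4 - (j + 1) = 2 * a + 2 by omega, ← hfN] at h2
      rw [h2] at es
      omega
    · rw [h1, ← hf0] at h2
      rw [h2] at es
      omega
  rw [hsum, ← hfsum, ← hgsum] at hccw ⊢
  have hbound := hf.two_mul_le_sum_cross_sub hg hfg0 (hfN.trans hgN.symm) hne hccw
  have hN : 2 * a + 3 ≤ N' := by
    by_contra hlt
    have l1 := le_sum_of_isStairStep q hlow (i := 0) (j := 1) (by omega) (by omega)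
    have l2 := le_sum_of_isStairStep q hlow (i := 1) (j := 2) (by omega) (by omega)
    have l3 := le_sum_of_isStairStep q hlow (i := 2) (j := 2 * a + 2) (by omega) (by omega)
    have u1 := le_sum_of_isStairStep _ hup (i := 0) (j := 1) (by omega) (by omega)
    have u2 := le_sum_of_isStairStep _ hup (i := 1) (j := 2) (by omega) (by omega)
    have u3 := le_sum_of_isStairStep _ hup (i := 2) (j := 2 * a + 2) (by omega) (by omega)
    rw [hfN, hf0] at efN
    simp only [Nat.sub_zero, hclose, show 2 * (a + a) + 4 - (2 * a + 2) = 2 * a + 2 by omega,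
      show 2 * (a + a) + 4 - 1 = 2 * (a + a) + 3 by omega,
      show 2 * (a + a) + 4 - 2 = 2 * (a + a) + 2 by omega] at u1 u2 u3
    push_cast at l1 l2 l3 u1 u2 u3 efN
    have d0 := (hdir 0 (by omega)).1 (by omega) (by omega)
    have d1 := (hdir 1 (by omega)).2.1 (by omega) (by omega)
    have d2 := (hdir (2 * (a + a) + 2) (by omega)).2.2.1 (by omega) (by omega)
    have d3 := (hdir (2 * (a + a) + 3) (by omega)).2.2.2 (by omega) (by omega)
    rw [show 2 * (a + a) + 3 + 1 = 2 * (a + a) + 4 by omega, hclose] at d3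
    simp only [zero_add, Nat.reduceAdd] at d0 d1
    rw [show 2 * (a + a) + 2 + 1 = 2 * (a + a) + 3 by omega] at d2
    have hmeet : q 2 = q (2 * (a + a) + 2) := Prod.ext (by omega) (by omega)
    have := hsim 1 (2 * (a + a) + 2) (by omega) (by omega) (q 2)
      (by simp only [onSeg, Nat.reduceAdd]; omega) (by rw [hmeet]; simp only [onSeg]; omega)
    omega
  omega

theorem realizes.le_area {a : ℕ} (ha : 1 ≤ a) {P : RectPolygon (2 * (a + a) + 4)}
    (h : realizes (twoStairSeq a a) P) : 2 * ((a : ℤ) + 1) ≤ P.area := by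
  have hup : ∀ {P : RectPolygon (2 * (a + a) + 4)}, realizes (twoStairSeq a a) P →
      (P.v ((0 : ℕ))).2 < (P.v ((1 : ℕ))).2 → 2 * ((a : ℤ) + 1) ≤ P.area := fun {P} h h0 =>
    P.area_rot ▸ h.rot.le_area_of_first_edge_right ha h0
  have hleft : ∀ {P : RectPolygon (2 * (a + a) + 4)}, realizes (twoStairSeq a a) P →
      (P.v ((1 : ℕ))).1 < (P.v ((0 : ℕ))).1 → 2 * ((a : ℤ) + 1) ≤ P.area := fun {P} h h0 =>
    P.area_rot ▸ hup h.rot (neg_lt_neg h0)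
  have hdown : ∀ {P : RectPolygon (2 * (a + a) + 4)}, realizes (twoStairSeq a a) P →
      (P.v ((1 : ℕ))).2 < (P.v ((0 : ℕ))).2 → 2 * ((a : ℤ) + 1) ≤ P.area := fun {P} h h0 =>
    P.area_rot ▸ hleft h.rot h0
  rcases lt_trichotomy (P.v ((0 : ℕ))).1 (P.v ((1 : ℕ))).1 with h1 | h1 | h1
  · exact h.le_area_of_first_edge_right ha h1
  · rcases lt_trichotomy (P.v ((0 : ℕ))).2 (P.v ((1 : ℕ))).2 with h2 | h2 | h2
    · exact hup h h2
    · have := P.nondeg ((0 : ℕ))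
      rw [← Nat.cast_succ] at this
      exact absurd (Prod.ext h1.symm h2.symm) this
    · exact hdown h h2
  · exact hleft h h1

/-- The vertices of the area-minimizing two-stair polygon: a stair of unit steps whose last step
goes up by two, followed by its translate by one unit to the left, traversed backwards. -/
def minStairVertex (a k : ℕ) : ℤ × ℤ :=
  if k < 2 * a + 2 then (((k + 1) / 2 : ℕ), (k / 2 : ℕ))
  else ((a : ℤ) + 1 - ((k - (2 * a + 2) + 1) / 2 : ℕ), (a : ℤ) + 2 - ((k - (2 * a + 2)) / 2 : ℕ))

theorem minStairVertex_of_lt {a k : ℕ} (hk : k < 2 * a + 2) :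
    minStairVertex a k = ((((k + 1) / 2 : ℕ) : ℤ), ((k / 2 : ℕ) : ℤ)) :=
  if_pos hk

theorem minStairVertex_of_le {a k : ℕ} (hk : 2 * a + 2 ≤ k) :
    minStairVertex a k = ((a : ℤ) + 1 - ((k - (2 * a + 2) + 1) / 2 : ℕ),
      (a : ℤ) + 2 - ((k - (2 * a + 2)) / 2 : ℕ)) :=
  if_neg hk.not_gt

/-- The edges of the area-minimizing two-stair polygon. -/
theorem minStairVertex_edge (a k : ℕ) (hk : k < 2 * (a + a) + 4) (p p' : ℤ × ℤ)
    (hp : minStairVertex a k = p)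
    (hp' : minStairVertex a ((k + 1) % (2 * (a + a) + 4)) = p') :
    ∃ t : ℕ, t ≤ a ∧
      ((k = 2 * t ∧ p.1 = t ∧ p.2 = t ∧ p'.1 = t + 1 ∧ p'.2 = t) ∨
      (k = 2 * t + 1 ∧ p.1 = t + 1 ∧ p.2 = t ∧ p'.1 = t + 1 ∧
        ((t < a ∧ p'.2 = t + 1) ∨ (t = a ∧ p'.2 = t + 2))) ∨
      (k = 2 * a + 2 + 2 * t ∧ p.1 = a + 1 - t ∧ p.2 = a + 2 - t ∧ p'.1 = a - t ∧
        p'.2 = a + 2 - t) ∨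
      (k = 2 * a + 3 + 2 * t ∧ p.1 = a - t ∧ p.2 = a + 2 - t ∧ p'.1 = a - t ∧
        ((t < a ∧ p'.2 = a + 1 - t) ∨ (t = a ∧ p'.2 = 0)))) := by
  rcases lt_or_ge k (2 * a + 2) with h | h
  · refine ⟨k / 2, by omega, ?_⟩
    rw [Nat.mod_eq_of_lt (by omega)] at hp'
    rw [minStairVertex_of_lt h] at hp
    rcases lt_or_ge (k + 1) (2 * a + 2) with h' | h'
    · rw [minStairVertex_of_lt h'] at hp'
      subst hp hp'
      dsimp only
      omega
    · rw [minStairVertex_of_le h'] at hp'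
      subst hp hp'
      dsimp only
      omega
  · refine ⟨(k - (2 * a + 2)) / 2, by omega, ?_⟩
    rw [minStairVertex_of_le h] at hp
    rcases Nat.lt_or_ge (k + 1) (2 * (a + a) + 4) with h' | h'
    · rw [Nat.mod_eq_of_lt h', minStairVertex_of_le (by omega)] at hp'
      subst hp hp'
      dsimp only
      omega
    · rw [show k + 1 = 2 * (a + a) + 4 by omega, Nat.mod_self,
        minStairVertex_of_lt (k := 0) (by omega)] at hp'
      subst hp hp'
      dsimp only
      omega

theorem add_one_mod_cases {n k : ℕ} (hk : k < n) :
    (k + 1 < n ∧ (k + 1) % n = k + 1) ∨ (k + 1 = n ∧ (k + 1) % n = 0) := by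
  rcases Nat.lt_or_ge (k + 1) n with h | h
  · exact Or.inl ⟨h, Nat.mod_eq_of_lt h⟩
  · have he : k + 1 = n := by omega
    exact Or.inr ⟨he, by rw [he, Nat.mod_self]⟩

/-- The points on the edges of the area-minimizing two-stair polygon. -/
theorem minStairVertex_onSeg (a k : ℕ) (hk : k < 2 * (a + a) + 4) (p : ℤ × ℤ)
    (hp : onSeg (minStairVertex a k) (minStairVertex a ((k + 1) % (2 * (a + a) + 4))) p) :
    ∃ t : ℕ, t ≤ a ∧
      ((k = 2 * t ∧ (minStairVertex a k).1 = t ∧ (minStairVertex a k).2 = t ∧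
        t ≤ p.1 ∧ p.1 ≤ t + 1 ∧ p.2 = t) ∨
      (k = 2 * t + 1 ∧ (minStairVertex a k).1 = t + 1 ∧ (minStairVertex a k).2 = t ∧
        p.1 = t + 1 ∧ t ≤ p.2 ∧ (p.2 ≤ t + 1 ∨ t = a ∧ p.2 ≤ t + 2)) ∨
      (k = 2 * a + 2 + 2 * t ∧ (minStairVertex a k).1 = a + 1 - t ∧
        (minStairVertex a k).2 = a + 2 - t ∧ a - t ≤ p.1 ∧ p.1 ≤ a + 1 - t ∧ p.2 = a + 2 - t) ∨
      (k = 2 * a + 3 + 2 * t ∧ (minStairVertex a k).1 = a - t ∧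
        (minStairVertex a k).2 = a + 2 - t ∧ p.1 = a - t ∧ p.2 ≤ a + 2 - t ∧
        (a + 1 - t ≤ p.2 ∨ t = a ∧ 0 ≤ p.2))) := by
  obtain ⟨t, ht, h1⟩ := minStairVertex_edge a k hk _ _ rfl rfl
  refine ⟨t, ht, ?_⟩
  simp only [onSeg] at hp
  generalize minStairVertex a ((k + 1) % (2 * (a + a) + 4)) = p1 at *
  generalize minStairVertex a k = p2 at *
  rcases h1 with h1 | h1 | h1 | h1
  · exact Or.inl (by omega)
  · exact Or.inr (Or.inl (by omega))
  · exact Or.inr (Or.inr (Or.inl (by omega)))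
  · exact Or.inr (Or.inr (Or.inr (by omega)))

theorem minStairVertex_simple (a k l : ℕ) (hkl : k < l) (hl : l < 2 * (a + a) + 4) (p : ℤ × ℤ)
    (hk : onSeg (minStairVertex a k) (minStairVertex a ((k + 1) % (2 * (a + a) + 4))) p)
    (hl' : onSeg (minStairVertex a l) (minStairVertex a ((l + 1) % (2 * (a + a) + 4))) p) :
    (l = k + 1 ∧ p = minStairVertex a l) ∨
      (k = 0 ∧ l + 1 = 2 * (a + a) + 4 ∧ p = minStairVertex a k) := by
  obtain ⟨t, ht, h1⟩ := minStairVertex_onSeg a k (by omega) p hk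
  obtain ⟨u, hu, h2⟩ := minStairVertex_onSeg a l hl p hl'
  clear hk hl'
  simp only [Prod.ext_iff]
  generalize minStairVertex a k = p1 at *
  generalize minStairVertex a l = p2 at *
  rcases h1 with h1 | h1 | h1 | h1 <;> rcases h2 with h2 | h2 | h2 | h2 <;> omega

theorem ZMod.val_add_one_eq_mod {n : ℕ} (hn : 2 ≤ n) (i : ZMod n) :
    (i + 1).val = (i.val + 1) % n := by
  have : Fact (1 < n) := ⟨hn⟩
  rw [ZMod.val_add, ZMod.val_one]

/-- A two-stair polygon of minimum area. -/
def minStairPolygon (a : ℕ) : RectPolygon (2 * (a + a) + 4) where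
  v i := minStairVertex a i.val
  nondeg i h := by
    rw [ZMod.val_add_one_eq_mod (by omega)] at h
    obtain ⟨t, ht, h1⟩ := minStairVertex_edge a i.val (ZMod.val_lt i) _ _ rfl rfl
    rw [h] at h1
    omega
  axis i := by
    rw [ZMod.val_add_one_eq_mod (by omega)]
    obtain ⟨t, ht, h1⟩ := minStairVertex_edge a i.val (ZMod.val_lt i) _ _ rfl rfl
    omega
  alt i := by
    rw [show i + 2 = (i + 1) + 1 by ring, ZMod.val_add_one_eq_mod (by omega) (i + 1)]
    obtain ⟨t, ht, h1⟩ := minStairVertex_edge a i.val (ZMod.val_lt i) _ _ rfl rfl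
    obtain ⟨u, hu, h2⟩ := minStairVertex_edge a (i + 1).val (ZMod.val_lt _) _ _ rfl rfl
    have hi := ZMod.val_add_one_eq_mod (by omega) i
    rw [← hi] at h1
    have hlt := ZMod.val_lt i
    have hc := add_one_mod_cases hlt
    rw [← hi] at hc
    generalize minStairVertex a (((i + 1).val + 1) % (2 * (a + a) + 4)) = p1 at *
    generalize minStairVertex a (i + 1).val = p2 at *
    generalize minStairVertex a i.val = p3 at *
    generalize (i + 1).val = k1 at *
    generalize i.val = k2 at *
    clear hi
    rcases h1 with h1 | h1 | h1 | h1 <;> rcases h2 with h2 | h2 | h2 | h2 <;> omega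
  simple i j hij p hpi hpj := by
    have hij' : j.val ≠ i.val := fun h => hij (ZMod.val_injective _ h)
    have hi := ZMod.val_lt i
    have hj := ZMod.val_lt j
    rw [ZMod.val_add_one_eq_mod (by omega)] at hpi hpj
    rw [← (ZMod.val_injective _).eq_iff, ← (ZMod.val_injective _).eq_iff (a := i),
      ZMod.val_add_one_eq_mod (by omega), ZMod.val_add_one_eq_mod (by omega)]
    rcases lt_or_gt_of_ne hij' with h | h
    · rcases minStairVertex_simple a _ _ h hi p hpj hpi with ⟨h1, h2⟩ | ⟨h1, h2, h3⟩
      · exact Or.inr ⟨by rw [← h1, Nat.mod_eq_of_lt hi], h2⟩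
      · exact Or.inl ⟨by rw [h2, h1, Nat.mod_self], h3⟩
    · rcases minStairVertex_simple a _ _ h hj p hpi hpj with ⟨h1, h2⟩ | ⟨h1, h2, h3⟩
      · exact Or.inl ⟨by rw [← h1, Nat.mod_eq_of_lt hj], h2⟩
      · exact Or.inr ⟨by rw [h2, h1, Nat.mod_self], h3⟩

theorem minStairPolygon_v_natCast (a : ℕ) {k : ℕ} (hk : k < 2 * (a + a) + 4) :
    (minStairPolygon a).v (k : ℕ) = minStairVertex a k := by
  simp only [minStairPolygon]
  rw [ZMod.val_cast_of_lt hk]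

theorem minStairPolygon_v_natCast_add_one (a k : ℕ) :
    (minStairPolygon a).v ((k + 1 : ℕ)) = minStairVertex a ((k + 1) % (2 * (a + a) + 4)) := by
  simp only [minStairPolygon]
  rw [ZMod.val_natCast]

theorem sum_range_two_mul (F : ℕ → ℤ) (m : ℕ) :
    ∑ k ∈ Finset.range (2 * m), F k = ∑ t ∈ Finset.range m, (F (2 * t) + F (2 * t + 1)) := by
  induction m with
  | zero => simp
  | succ m ih =>
    rw [show 2 * (m + 1) = 2 * m + 1 + 1 by ring, Finset.sum_range_succ, Finset.sum_range_succ,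
      ih, Finset.sum_range_succ]
    ring

theorem sum_cross_minStairVertex (a : ℕ) :
    ∑ k ∈ Finset.range (2 * (a + a) + 4),
      cross (minStairVertex a k) (minStairVertex a ((k + 1) % (2 * (a + a) + 4))) =
        4 * (a + 1) := by
  generalize hF : (fun k => cross (minStairVertex a k)
    (minStairVertex a ((k + 1) % (2 * (a + a) + 4)))) = F
  have hlow : ∀ t < a, F (2 * t) + F (2 * t + 1) = 1 := by
    intro t ht
    obtain ⟨u, hu, h1⟩ := minStairVertex_edge a (2 * t) (by omega) _ _ rfl rfl
    obtain ⟨w, hw, h2⟩ := minStairVertex_edge a (2 * t + 1) (by omega) _ _ rfl rfl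
    obtain ⟨-, e1, e2, e3, e4⟩ := h1.resolve_right (by omega)
    obtain ⟨-, f1, f2, f3, f4⟩ := (h2.resolve_left (by omega)).resolve_right (by omega)
    obtain rfl : u = t := by omega
    obtain rfl : w = u := by omega
    have f4 := (f4.resolve_right (by omega)).2
    simp only [← hF, cross, e1, e2, e3, e4, f1, f2, f3, f4]
    ring
  have hmid : F (2 * a) + F (2 * a + 1) = a + 2 := by
    obtain ⟨u, hu, h1⟩ := minStairVertex_edge a (2 * a) (by omega) _ _ rfl rfl
    obtain ⟨w, hw, h2⟩ := minStairVertex_edge a (2 * a + 1) (by omega) _ _ rfl rfl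
    obtain ⟨-, e1, e2, e3, e4⟩ := h1.resolve_right (by omega)
    obtain ⟨-, f1, f2, f3, f4⟩ := (h2.resolve_left (by omega)).resolve_right (by omega)
    obtain rfl : u = a := by omega
    obtain rfl : w = u := by omega
    have f4 := (f4.resolve_left (by omega)).2
    simp only [← hF, cross, e1, e2, e3, e4, f1, f2, f3, f4]
    ring
  have hup : ∀ t < a + 1, F (2 * (a + 1 + t)) + F (2 * (a + 1 + t) + 1) = 2 := by
    intro t ht
    obtain ⟨u, hu, h1⟩ := minStairVertex_edge a (2 * (a + 1 + t)) (by omega) _ _ rfl rfl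
    obtain ⟨w, hw, h2⟩ := minStairVertex_edge a (2 * (a + 1 + t) + 1) (by omega) _ _ rfl rfl
    obtain ⟨-, e1, e2, e3, e4⟩ :=
      ((h1.resolve_left (by omega)).resolve_left (by omega)).resolve_right (by omega)
    obtain ⟨-, f1, f2, f3, f4⟩ :=
      ((h2.resolve_left (by omega)).resolve_left (by omega)).resolve_left (by omega)
    obtain rfl : u = t := by omega
    obtain rfl : w = u := by omega
    simp only [← hF, cross, e1, e2, e3, e4, f1, f2, f3]
    rcases f4 with ⟨-, f4⟩ | ⟨rfl, f4⟩ <;> rw [f4] <;> ring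
  rw [show Finset.range (2 * (a + a) + 4) = Finset.range (2 * ((a + 1) + (a + 1))) by
    congr 1; omega, sum_range_two_mul, Finset.sum_range_add, Finset.sum_range_succ, hmid,
    Finset.sum_congr rfl fun t ht => hlow t (Finset.mem_range.1 ht),
    Finset.sum_congr rfl fun t ht => hup t (Finset.mem_range.1 ht)]
  simp only [Finset.sum_const, Finset.card_range, nsmul_eq_mul]
  push_cast
  ring

theorem sum_cross_minStairPolygon (a : ℕ) :
    ∑ i, cross ((minStairPolygon a).v i) ((minStairPolygon a).v (i + 1)) = 4 * (a + 1) := by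
  rw [RectPolygon.sum_cross_eq_sum_range, ← sum_cross_minStairVertex]
  refine Finset.sum_congr rfl fun k hk => ?_
  rw [minStairPolygon_v_natCast a (Finset.mem_range.1 hk), minStairPolygon_v_natCast_add_one]

theorem area_minStairPolygon (a : ℕ) : (minStairPolygon a).area = 2 * ((a : ℤ) + 1) := by
  rw [RectPolygon.area, sum_cross_minStairPolygon]
  omega

theorem minStairPolygon_dvec (a : ℕ) {k : ℕ} (hk : k < 2 * (a + a) + 4) :
    (minStairPolygon a).dvec (k : ℕ) =
      minStairVertex a ((k + 1) % (2 * (a + a) + 4)) - minStairVertex a k := by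
  rw [RectPolygon.dvec, ← Nat.cast_succ, minStairPolygon_v_natCast a hk,
    minStairPolygon_v_natCast_add_one]

theorem minStairPolygon_dvec_sign (a : ℕ) {k : ℕ} (hk : k < 2 * (a + a) + 4) (d : ℤ × ℤ)
    (hd : (minStairPolygon a).dvec (k : ℕ) = d) :
    (k < 2 * a + 2 ∧ k % 2 = 0 ∧ 0 < d.1 ∧ d.2 = 0) ∨
    (k < 2 * a + 2 ∧ k % 2 = 1 ∧ d.1 = 0 ∧ 0 < d.2) ∨
    (2 * a + 2 ≤ k ∧ k % 2 = 0 ∧ d.1 < 0 ∧ d.2 = 0) ∨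
    (2 * a + 2 ≤ k ∧ k % 2 = 1 ∧ d.1 = 0 ∧ d.2 < 0) := by
  subst hd
  rw [minStairPolygon_dvec a hk]
  obtain ⟨t, ht, h⟩ := minStairVertex_edge a k hk _ _ rfl rfl
  simp only [Prod.fst_sub, Prod.snd_sub]
  generalize minStairVertex a ((k + 1) % (2 * (a + a) + 4)) = p1 at *
  generalize minStairVertex a k = p2 at *
  rcases h with h | h | h | h
  · exact Or.inl (by omega)
  · exact Or.inr (Or.inl (by omega))
  · exact Or.inr (Or.inr (Or.inl (by omega)))
  · exact Or.inr (Or.inr (Or.inr (by omega)))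

theorem realizes_minStairPolygon (a : ℕ) : realizes (twoStairSeq a a) (minStairPolygon a) := by
  refine ⟨(length_twoStairSeq a a).symm, ?_, fun i => ?_⟩
  · rw [RectPolygon.ccw, sum_cross_minStairPolygon]
    positivity
  obtain ⟨k, hk⟩ := i
  have hk' := hk
  rw [length_twoStairSeq] at hk'
  obtain ⟨l, hl, hl', hlk⟩ : ∃ l < 2 * (a + a) + 4,
      ((k : ℕ) : ZMod (2 * (a + a) + 4)) - 1 = (l : ℕ) ∧
        (k = l + 1 ∨ k = 0 ∧ l = 2 * (a + a) + 3) := by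
    obtain _ | k := k
    · refine ⟨2 * (a + a) + 3, by omega, ?_, by omega⟩
      rw [sub_eq_iff_eq_add, ← Nat.cast_succ, Nat.succ_eq_add_one, add_assoc, ZMod.natCast_self,
        Nat.cast_zero]
    · exact ⟨k, by omega, by push_cast; ring, by omega⟩
  simp only [List.get_eq_getElem, twoStairSeq_getElem, RectPolygon.convexAt,
    RectPolygon.reflexAt, cross, hl', decide_eq_true_eq, decide_eq_false_iff_not]
  have s1 := minStairPolygon_dvec_sign a hl _ rfl
  have s2 := minStairPolygon_dvec_sign a hk' _ rfl
  generalize (minStairPolygon a).dvec (l : ℕ) = d at *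
  generalize (minStairPolygon a).dvec (k : ℕ) = e at *
  have hm : (d.2 = 0 ∧ e.1 = 0) ∨ (d.1 = 0 ∧ e.2 = 0) := by omega
  rcases hm with ⟨z1, z2⟩ | ⟨z1, z2⟩
  · rw [z1, z2, zero_mul, sub_zero, mul_pos_iff, mul_neg_iff]
    omega
  · rw [z1, z2, zero_mul, zero_sub, neg_pos, neg_lt_zero, mul_pos_iff, mul_neg_iff]
    omega

/-- For equal stair lengths `b = a ≥ 1`, the minimum area of a polygon realizing
the two-opposite-stair xy-monotone angle sequence with both stairs having `a`
reflex vertices is exactly `2(a+1)`, which is one more than the general lower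
bound `(a+1)(q+1)(q+2)/2 − a + r(q+2)` evaluated at `q = 0`, `r = a`. -/
theorem two_stair_equal_min_area (a : ℕ) (ha : 1 ≤ a) :
    IsLeast {A : ℤ | ∃ P : RectPolygon (2 * (a + a) + 4),
        realizes (twoStairSeq a a) P ∧ A = P.area} (2 * ((a : ℤ) + 1)) ∧
    2 * ((a : ℤ) + 1) =
      (((a : ℤ) + 1) * (0 + 1) * (0 + 2) / 2 - a + a * (0 + 2)) + 1 := by
  refine ⟨⟨⟨minStairPolygon a, realizes_minStairPolygon a, (area_minStairPolygon a).symm⟩, ?_⟩,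
    by omega⟩
  rintro A ⟨P, hP, rfl⟩
  exact hP.le_area ha
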